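/- arXiv:2201.10288 — 3 statements merged into one kernel-verified Lean document; each statement's English description precedes it below -/
import Mathlib

section
/- The function F_a is holomorphic (complex-differentiable) at every point of the open set ℂ \ (-∞, -4m²]; moreover the defining integral also converges at z = -4m² and F_a extends continuously to the point z = -4m². -/
open MeasureTheory Complex Filter

/-- The half-line `(-∞, -4m²]` viewed as a subset of `ℂ`. -/
def cutSet (m : ℝ) : Set ℂ := {z : ℂ | z.im = 0 ∧ z.re ≤ -4 * m ^ 2}

/-- The function `F_a(z) = ∫_{4m²}^∞ √(1 - 4m²/u) (1/(u+a) - 1/(u+z)) du`. -/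
noncomputable def Fa (m a : ℝ) (z : ℂ) : ℂ :=
  ∫ u in Set.Ioi (4 * m ^ 2), (Real.sqrt (1 - 4 * m ^ 2 / u) : ℂ) *
    (1 / ((u : ℂ) + (a : ℂ)) - 1 / ((u : ℂ) + z))

open scoped Topology

/-- Every complex number has a square root in the closed right half-plane. -/
lemma exists_sq_eq_re_nonneg (x : ℂ) : ∃ y : ℂ, y ^ 2 = x ∧ 0 ≤ y.re := by
  obtain ⟨y, hy⟩ := IsAlgClosed.exists_pow_nat_eq x (n := 2) (by norm_num)
  rcases le_total 0 y.re with h | h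
  · exact ⟨y, hy, h⟩
  · exact ⟨-y, by rw [neg_sq, hy], by simpa using h⟩

/-- A square root of a point of the slit plane can be chosen in the open right half-plane. -/
lemma exists_sq_eq_re_pos {x : ℂ} (hx : x ∈ slitPlane) : ∃ y : ℂ, y ^ 2 = x ∧ 0 < y.re := by
  obtain ⟨y, rfl, h⟩ := exists_sq_eq_re_nonneg x
  refine ⟨y, rfl, lt_of_le_of_ne h fun h0 => ?_⟩
  rw [mem_slitPlane_iff] at hx
  simp only [pow_two, mul_re, mul_im, ← h0] at hx
  rcases hx with hx | hx
  · nlinarith [mul_self_nonneg y.im]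
  · simp at hx

/-- Away from the cut, `‖u + z‖` is bounded below by a multiple of `u`, uniformly near `z`. -/
lemma exists_norm_add_ge {c : ℝ} (hc : 0 < c) {z₀ : ℂ} (hz : z₀ + c ∈ slitPlane) :
    ∃ δ > 0, ∀ z ∈ Metric.ball z₀ (δ * c), ∀ u : ℝ, c < u → δ * u ≤ ‖(u : ℂ) + z‖ := by
  have hne : ∀ x ∈ Set.Icc 0 (1 / c), 1 + (x : ℂ) * z₀ ≠ 0 := by
    rintro x ⟨hx0, hx1⟩ h
    have hre : 1 + x * z₀.re = 0 := by simpa using congrArg Complex.re h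
    have him : x * z₀.im = 0 := by simpa using congrArg Complex.im h
    have hx : 0 < x := by
      rcases hx0.eq_or_lt with rfl | hx
      · simp at hre
      · exact hx
    rw [le_div_iff₀ hc] at hx1
    rw [mem_slitPlane_iff] at hz
    rcases hz with hz | hz
    · simp only [add_re, ofReal_re] at hz
      nlinarith [mul_pos hx hz]
    · simp only [add_im, ofReal_im, add_zero] at hz
      exact hz ((mul_eq_zero.1 him).resolve_left hx.ne')
  obtain ⟨x₀, hx₀, hmin⟩ := (isCompact_Icc (a := (0 : ℝ)) (b := 1 / c)).exists_isMinOn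
    ⟨0, by simp [hc.le]⟩
    (f := fun x : ℝ => ‖1 + (x : ℂ) * z₀‖) (by fun_prop)
  set ε := ‖1 + (x₀ : ℂ) * z₀‖
  have hεpos : 0 < ε := norm_pos_iff.2 (hne x₀ hx₀)
  refine ⟨ε / 2, by positivity, fun z hz u hu => ?_⟩
  have hu0 : 0 < u := hc.trans hu
  have h1 : ε ≤ ‖1 + ((1 / u : ℝ) : ℂ) * z₀‖ :=
    hmin (show 1 / u ∈ Set.Icc 0 (1 / c) from ⟨by positivity, by gcongr⟩)
  have h2 : ‖(u : ℂ) + z₀‖ = u * ‖1 + ((1 / u : ℝ) : ℂ) * z₀‖ := by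
    have hu' : (u : ℂ) ≠ 0 := by exact_mod_cast hu0.ne'
    rw [← Complex.norm_of_nonneg hu0.le, ← norm_mul, Complex.norm_of_nonneg hu0.le]
    congr 1
    push_cast
    field_simp
  have h3 : ‖(u : ℂ) + z₀‖ ≤ ‖(u : ℂ) + z‖ + ‖z - z₀‖ := by
    have := norm_sub_le ((u : ℂ) + z) (z - z₀)
    rwa [show (u : ℂ) + z - (z - z₀) = u + z₀ by ring] at this
  rw [mem_ball_iff_norm] at hz
  nlinarith [mul_le_mul_of_nonneg_left h1 hu0.le]

/-- The weight `1 / (√(u - c) u)` dominating all integrands below. -/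
lemma integrableOn_inv_sqrt_sub_mul {c : ℝ} (hc : 0 < c) :
    IntegrableOn (fun u : ℝ => 1 / (√(u - c) * u)) (Set.Ioi c) := by
  have hsc : 0 < √c := Real.sqrt_pos.2 hc
  refine integrableOn_Ioi_deriv_of_nonneg
    (g := fun u => 2 / √c * Real.arctan (√(u - c) / √c)) (l := 2 / √c * (Real.pi / 2)) ?_ ?_ ?_ ?_
  · exact Continuous.continuousWithinAt (by fun_prop)
  · intro u hu
    have hv : 0 < u - c := sub_pos.2 hu
    have hs : 0 < √(u - c) := Real.sqrt_pos.2 hv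
    have hu0 : 0 < u := hc.trans hu
    have h := (((((hasDerivAt_id u).sub_const c).sqrt hv.ne').div_const √c).arctan).const_mul
      (2 / √c)
    refine h.congr_deriv ?_
    have h1 : 1 + (√(id u - c) / √c) ^ 2 = u / c := by
      rw [id, div_pow, Real.sq_sqrt hv.le, Real.sq_sqrt hc.le]
      field_simp
      ring
    rw [h1, id]
    field_simp
    rw [Real.sq_sqrt hc.le]
  · intro u hu
    have : 0 < u := hc.trans hu
    positivity
  · refine Tendsto.const_mul _ ?_
    refine (tendsto_nhds_of_tendsto_nhdsWithin Real.tendsto_arctan_atTop).comp ?_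
    exact (Real.tendsto_sqrt_atTop.comp
      (tendsto_atTop_add_const_right _ (-c) tendsto_id)).atTop_div_const hsc

lemma one_div_sq_le {c u : ℝ} (hc : 0 < c) (hu : c < u) :
    1 / u ^ 2 ≤ 1 / √c * (1 / (√(u - c) * u)) := by
  have hv : 0 < u - c := sub_pos.2 hu
  have hu0 : 0 < u := hc.trans hu
  have hsc : 0 < √c := Real.sqrt_pos.2 hc
  have hs : 0 < √(u - c) := Real.sqrt_pos.2 hv
  rw [← one_div_mul_one_div_rev, mul_comm (1 / u), ← mul_assoc, one_div_mul_one_div,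
    one_div_mul_one_div]
  refine one_div_le_one_div_of_le (by positivity) ?_
  have : √c * √(u - c) ≤ u := by
    nlinarith [Real.sq_sqrt hc.le, Real.sq_sqrt hv.le, sq_nonneg (√c - √(u - c))]
  nlinarith

lemma hasDerivAt_log_sub_log {k : ℂ} (hk : 0 < k.re) (s : ℝ) :
    HasDerivAt (fun s : ℝ => (log (s - I * k) - log (s + I * k)) / (2 * I * k))
      (1 / ((s : ℂ) ^ 2 + k ^ 2)) s := by
  have hk0 : k ≠ 0 := by rintro rfl; simp at hk
  have h1 : (s : ℂ) - I * k ∈ slitPlane := mem_slitPlane_iff.2 (Or.inr (by simpa using hk.ne'))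
  have h2 : (s : ℂ) + I * k ∈ slitPlane := mem_slitPlane_iff.2 (Or.inr (by simpa using hk.ne'))
  have hs : HasDerivAt (fun s : ℝ => (s : ℂ)) 1 s := Complex.ofRealCLM.hasDerivAt
  have h := (((hs.sub_const (I * k)).clog_real h1).sub
    ((hs.add_const (I * k)).clog_real h2)).div_const (2 * I * k)
  refine h.congr_deriv ?_
  have e1 := slitPlane_ne_zero h1
  have e2 := slitPlane_ne_zero h2
  have e : (s : ℂ) ^ 2 + k ^ 2 = (s - I * k) * (s + I * k) := by
    linear_combination k ^ 2 * I_sq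
  rw [e]
  field_simp
  ring

lemma tendsto_log_sub_log_atTop (k : ℂ) :
    Tendsto (fun s : ℝ => log (s - I * k) - log (s + I * k)) atTop (𝓝 0) := by
  have hinv : Tendsto (fun s : ℝ => ((s⁻¹ : ℝ) : ℂ)) atTop (𝓝 0) := by
    exact (continuous_ofReal.tendsto 0).comp tendsto_inv_atTop_zero
  have hlog : ∀ b : ℂ, Tendsto (fun s : ℝ => 1 + ((s⁻¹ : ℝ) : ℂ) * b) atTop (𝓝 1) := by
    intro b
    simpa using (hinv.mul_const b).const_add 1
  have hl : ∀ b : ℂ, Tendsto (fun s : ℝ => log (1 + ((s⁻¹ : ℝ) : ℂ) * b)) atTop (𝓝 0) := by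
    intro b
    have := (hlog b).clog one_mem_slitPlane
    simpa using this
  have hd := (hl (-(I * k))).sub (hl (I * k))
  rw [sub_zero] at hd
  refine hd.congr' ?_
  filter_upwards [eventually_gt_atTop 0, (hlog (-(I * k))).eventually_ne one_ne_zero,
    (hlog (I * k)).eventually_ne one_ne_zero] with s hs h1 h2
  have hs' : (s : ℂ) ≠ 0 := by exact_mod_cast hs.ne'
  have e : ∀ b : ℂ, (s : ℂ) + b = s * (1 + ((s⁻¹ : ℝ) : ℂ) * b) := by
    intro b
    push_cast
    field_simp
  rw [sub_eq_add_neg (s : ℂ), e (-(I * k)), e (I * k), log_ofReal_mul hs h1, log_ofReal_mul hs h2]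
  ring

lemma log_neg_I_mul_sub_log_I_mul {k : ℂ} (hk : 0 < k.re) :
    log (-I * k) - log (I * k) = -(Real.pi * I) := by
  have hk0 : k ≠ 0 := by rintro rfl; simp at hk
  have harg := abs_lt.1 (abs_arg_lt_pi_div_two_iff.2 (Or.inl hk))
  have hpi := Real.pi_pos
  rw [log_mul (by simp) hk0 (by rw [arg_neg_I]; constructor <;> linarith),
    log_mul (by simp) hk0 (by rw [arg_I]; constructor <;> linarith), log_I, log_neg_I]
  ring

lemma integral_inv_sqrt_sub_mul {c : ℝ} {k : ℂ} (hk : 0 < k.re)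
    (hint : IntegrableOn (fun u : ℝ => 1 / ((√(u - c) : ℂ) * ((u : ℂ) - c + k ^ 2))) (Set.Ioi c)) :
    ∫ u in Set.Ioi c, 1 / ((√(u - c) : ℂ) * ((u : ℂ) - c + k ^ 2)) = Real.pi / k := by
  have hk0 : k ≠ 0 := by rintro rfl; simp at hk
  set G : ℝ → ℂ := fun s => (log (s - I * k) - log (s + I * k)) / (2 * I * k) with hG
  have hGc : Continuous G :=
    continuous_iff_continuousAt.2 fun s => (hasDerivAt_log_sub_log hk s).continuousAt
  have hlim : Tendsto G atTop (𝓝 0) := by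
    simpa using (tendsto_log_sub_log_atTop k).div_const (2 * I * k)
  have h := integral_Ioi_of_hasDerivAt_of_tendsto (f := fun u : ℝ => 2 * G (√(u - c)))
    (f' := fun u : ℝ => 1 / ((√(u - c) : ℂ) * ((u : ℂ) - c + k ^ 2))) (a := c) (m := 0)
    (Continuous.continuousWithinAt (by fun_prop)) ?_ hint ?_
  · rw [h, sub_self, Real.sqrt_zero, hG]
    have := log_neg_I_mul_sub_log_I_mul hk
    simp only [ofReal_zero, zero_sub, zero_add, neg_mul] at this ⊢
    rw [this]
    field_simp
  · intro u hu
    have hv : 0 < u - c := sub_pos.2 hu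
    have hs : 0 < √(u - c) := Real.sqrt_pos.2 hv
    have hs' : (√(u - c) : ℂ) ≠ 0 := by exact_mod_cast hs.ne'
    have hd := ((hasDerivAt_log_sub_log hk (√(u - c))).scomp u
      (((hasDerivAt_id u).sub_const c).sqrt hv.ne')).const_mul 2
    refine hd.congr_deriv ?_
    have hsq : (√(u - c) : ℂ) ^ 2 = u - c := by
      rw [← ofReal_pow, Real.sq_sqrt hv.le, ofReal_sub]
    rw [hsq, real_smul, id]
    push_cast
    rw [one_div_mul_one_div, mul_one_div, mul_assoc, div_mul_cancel_left₀ two_ne_zero, one_div]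
  · simpa [sub_eq_add_neg] using (hlim.comp (Real.tendsto_sqrt_atTop.comp
      (tendsto_atTop_add_const_right _ (-c) tendsto_id))).const_mul 2

lemma integrableOn_Ioi_of_norm_le {c C : ℝ} (hc : 0 < c) {f : ℝ → ℂ} (hf : Measurable f)
    (h : ∀ u, c < u → ‖f u‖ ≤ C * (1 / (√(u - c) * u))) : IntegrableOn f (Set.Ioi c) := by
  refine Integrable.mono' ((integrableOn_inv_sqrt_sub_mul hc).const_mul C)
    hf.aestronglyMeasurable ?_
  filter_upwards [ae_restrict_mem measurableSet_Ioi] with u hu using h u hu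

lemma sqrt_one_sub_div {c u : ℝ} (hc : 0 < c) (hu : c < u) : √(1 - c / u) = √(u - c) / √u := by
  have hu0 : 0 < u := hc.trans hu
  rw [← Real.sqrt_div (sub_pos.2 hu).le, sub_div, div_self hu0.ne']

lemma sqrt_one_sub_div_le_one {c u : ℝ} (hc : 0 < c) (hu : c < u) : √(1 - c / u) ≤ 1 := by
  have hu0 : 0 < u := hc.trans hu
  rw [Real.sqrt_le_one]
  linarith [div_pos hc hu0]

lemma ofReal_add_ne_zero {c u : ℝ} {z : ℂ} (hz : z + c ∈ slitPlane) (hu : c < u) :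
    (u : ℂ) + z ≠ 0 := by
  intro h
  have : z + c = ((c - u : ℝ) : ℂ) := by push_cast; linear_combination h
  rw [this, ofReal_mem_slitPlane] at hz
  linarith

lemma integrableOn_dispersion {c : ℝ} (hc : 0 < c) {a z : ℂ} (ha : a + c ∈ slitPlane)
    (hz : z + c ∈ slitPlane) :
    IntegrableOn (fun u : ℝ => (√(1 - c / u) : ℂ) * (1 / ((u : ℂ) + a) - 1 / ((u : ℂ) + z)))
      (Set.Ioi c) := by
  obtain ⟨δ₁, hδ₁, h₁⟩ := exists_norm_add_ge hc ha
  obtain ⟨δ₂, hδ₂, h₂⟩ := exists_norm_add_ge hc hz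
  refine integrableOn_Ioi_of_norm_le (C := ‖z - a‖ / (δ₁ * δ₂) * (1 / √c)) hc (by fun_prop)
    fun u hu => ?_
  have hu0 : 0 < u := hc.trans hu
  have g₁ := h₁ a (Metric.mem_ball_self (by positivity)) u hu
  have g₂ := h₂ z (Metric.mem_ball_self (by positivity)) u hu
  have n₁ := ofReal_add_ne_zero ha hu
  have n₂ := ofReal_add_ne_zero hz hu
  have e : 1 / ((u : ℂ) + a) - 1 / ((u : ℂ) + z) = (z - a) / ((u + a) * (u + z)) := by
    field_simp
    ring
  rw [e, norm_mul, norm_div, norm_mul, Complex.norm_of_nonneg (Real.sqrt_nonneg _)]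
  calc √(1 - c / u) * (‖z - a‖ / (‖(u : ℂ) + a‖ * ‖(u : ℂ) + z‖))
      ≤ 1 * (‖z - a‖ / ((δ₁ * u) * (δ₂ * u))) := by
        gcongr
        exact sqrt_one_sub_div_le_one hc hu
    _ = ‖z - a‖ / (δ₁ * δ₂) * (1 / u ^ 2) := by field_simp
    _ ≤ ‖z - a‖ / (δ₁ * δ₂) * (1 / √c * (1 / (√(u - c) * u))) := by
        gcongr ?_ * ?_
        exact one_div_sq_le hc hu
    _ = _ := by ring

/-- The integrand is also integrable at the branch point `z = -c`. -/
lemma integrableOn_dispersion_branch {c : ℝ} (hc : 0 < c) {a : ℂ} (ha : a + c ∈ slitPlane) :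
    IntegrableOn (fun u : ℝ => (√(1 - c / u) : ℂ) * (1 / ((u : ℂ) + a) - 1 / ((u : ℂ) + -c)))
      (Set.Ioi c) := by
  obtain ⟨δ, hδ, h⟩ := exists_norm_add_ge hc ha
  refine integrableOn_Ioi_of_norm_le (C := ‖-c - a‖ / (√c * δ)) hc (by fun_prop) fun u hu => ?_
  have hu0 : 0 < u := hc.trans hu
  have hv : 0 < u - c := sub_pos.2 hu
  have hs : 0 < √(u - c) := Real.sqrt_pos.2 hv
  have hsc : 0 < √c := Real.sqrt_pos.2 hc
  have g := h a (Metric.mem_ball_self (by positivity)) u hu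
  have n₁ := ofReal_add_ne_zero ha hu
  have n₂ : (u : ℂ) + -c ≠ 0 := by
    rw [← sub_eq_add_neg, ← ofReal_sub]
    exact_mod_cast hv.ne'
  have e : 1 / ((u : ℂ) + a) - 1 / ((u : ℂ) + -c) = (-c - a) / ((u + a) * ((u - c : ℝ) : ℂ)) := by
    push_cast
    rw [← sub_eq_add_neg] at n₂ ⊢
    field_simp
    ring
  rw [e, norm_mul, norm_div, norm_mul, Complex.norm_of_nonneg (Real.sqrt_nonneg _),
    Complex.norm_of_nonneg hv.le, sqrt_one_sub_div hc hu]
  calc √(u - c) / √u * (‖-c - a‖ / (‖(u : ℂ) + a‖ * (u - c)))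
      ≤ √(u - c) / √c * (‖-c - a‖ / ((δ * u) * (u - c))) := by gcongr
    _ = √(u - c) / √c * (‖-c - a‖ / ((δ * u) * √(u - c) ^ 2)) := by rw [Real.sq_sqrt hv.le]
    _ = ‖-c - a‖ / (√c * δ) * (1 / (√(u - c) * u)) := by field_simp

lemma differentiableAt_dispersion {c : ℝ} (hc : 0 < c) {a z₀ : ℂ} (ha : a + c ∈ slitPlane)
    (hz : z₀ + c ∈ slitPlane) :
    DifferentiableAt ℂ (fun z : ℂ => ∫ u in Set.Ioi c,
      (√(1 - c / u) : ℂ) * (1 / ((u : ℂ) + a) - 1 / ((u : ℂ) + z))) z₀ := by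
  obtain ⟨δ, hδ, h⟩ := exists_norm_add_ge hc hz
  have hpos : ∀ z ∈ Metric.ball z₀ (δ * c), ∀ u : ℝ, c < u → (u : ℂ) + z ≠ 0 := by
    intro z hz u hu
    exact norm_pos_iff.1 ((mul_pos hδ (hc.trans hu)).trans_le (h z hz u hu))
  refine (hasDerivAt_integral_of_dominated_loc_of_deriv_le
    (μ := volume.restrict (Set.Ioi c))
    (F := fun z (u : ℝ) => (√(1 - c / u) : ℂ) * (1 / ((u : ℂ) + a) - 1 / ((u : ℂ) + z)))
    (F' := fun z (u : ℝ) => (√(1 - c / u) : ℂ) * (1 / ((u : ℂ) + z) ^ 2))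
    (bound := fun u => 1 / δ ^ 2 * (1 / √c) * (1 / (√(u - c) * u)))
    (Metric.ball_mem_nhds z₀ (mul_pos hδ hc)) (Eventually.of_forall fun z => ?_)
    (integrableOn_dispersion hc ha hz) ?_ ?_
    ((integrableOn_inv_sqrt_sub_mul hc).const_mul _) ?_).2.differentiableAt
  · exact Measurable.aestronglyMeasurable (by fun_prop)
  · exact Measurable.aestronglyMeasurable (by fun_prop)
  · filter_upwards [ae_restrict_mem measurableSet_Ioi] with u hu z hz
    have hu0 : 0 < u := hc.trans hu
    have g := h z hz u hu
    rw [norm_mul, norm_div, norm_pow, norm_one, Complex.norm_of_nonneg (Real.sqrt_nonneg _)]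
    calc √(1 - c / u) * (1 / ‖(u : ℂ) + z‖ ^ 2) ≤ 1 * (1 / (δ * u) ^ 2) := by
          gcongr
          exact sqrt_one_sub_div_le_one hc hu
      _ = 1 / δ ^ 2 * (1 / u ^ 2) := by field_simp
      _ ≤ 1 / δ ^ 2 * (1 / √c * (1 / (√(u - c) * u))) := by
          gcongr ?_ * ?_
          exact one_div_sq_le hc hu
      _ = _ := by ring
  · filter_upwards [ae_restrict_mem measurableSet_Ioi] with u hu z hz
    have n := hpos z hz u hu
    have hd := ((((hasDerivAt_id z).const_add (u : ℂ)).inv n).const_sub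
      (1 / ((u : ℂ) + a))).const_mul (√(1 - c / u) : ℂ)
    simp only [one_div]
    simpa [neg_div] using hd

/-- Quantitative continuity at the branch point: subtracting the value of `1 / √u` at the pole
`u = -z` leaves an elementary integral and an absolutely convergent remainder, uniformly in `z`. -/
lemma norm_dispersion_sub_le {c : ℝ} (hc : 0 < c) {a z : ℂ} (ha : a + c ∈ slitPlane)
    (hz : z + c ∈ slitPlane) (hzc : ‖z + c‖ ≤ c / 2) :
    ‖(∫ u in Set.Ioi c, (√(1 - c / u) : ℂ) * (1 / ((u : ℂ) + a) - 1 / ((u : ℂ) + z))) -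
      ∫ u in Set.Ioi c, (√(1 - c / u) : ℂ) * (1 / ((u : ℂ) + a) - 1 / ((u : ℂ) + -c))‖ ≤
    (Real.pi * √‖z + c‖ + ‖z + c‖ * ∫ u in Set.Ioi c, 1 / (√(u - c) * u)) / √(c / 2) := by
  obtain ⟨k, hk, hkre⟩ := exists_sq_eq_re_pos hz
  obtain ⟨σ, hσ, hσre⟩ := exists_sq_eq_re_nonneg (-z)
  have hk0 : k ≠ 0 := by rintro rfl; simp at hkre
  have hnk : √‖z + c‖ = ‖k‖ := by rw [← hk, norm_pow, Real.sqrt_sq (norm_nonneg _)]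
  have hnσ : √(c / 2) ≤ ‖σ‖ := by
    refine Real.sqrt_le_iff.2 ⟨norm_nonneg _, ?_⟩
    rw [← norm_pow, hσ]
    have := norm_sub_le (z + c) z
    rw [show z + c - z = (c : ℂ) by ring, Complex.norm_of_nonneg hc.le] at this
    rw [norm_neg]
    linarith
  have hsc : 0 < √(c / 2) := Real.sqrt_pos.2 (by positivity)
  have hσ0 : σ ≠ 0 := norm_pos_iff.1 (hsc.trans_le hnσ)
  obtain ⟨δ, hδ, h⟩ := exists_norm_add_ge hc hz
  have hrem : ∀ u, c < u →
      ‖1 / ((√(u - c) : ℂ) * √u * (√u + σ))‖ ≤ 1 / (√(u - c) * u) := by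
    intro u hu
    have hu0 : 0 < u := hc.trans hu
    have hs : 0 < √(u - c) := Real.sqrt_pos.2 (sub_pos.2 hu)
    have hsu : 0 < √u := Real.sqrt_pos.2 hu0
    have hge : √u ≤ ‖(√u : ℂ) + σ‖ := by
      refine le_trans ?_ (Complex.re_le_norm _)
      simpa using hσre
    rw [norm_div, norm_one, norm_mul, norm_mul, Complex.norm_of_nonneg hs.le,
      Complex.norm_of_nonneg hsu.le]
    calc 1 / (√(u - c) * √u * ‖(√u : ℂ) + σ‖) ≤ 1 / (√(u - c) * √u * √u) := by gcongr
      _ = 1 / (√(u - c) * u) := by rw [mul_assoc, Real.mul_self_sqrt hu0.le]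
  have hint₁ : IntegrableOn (fun u : ℝ => 1 / ((√(u - c) : ℂ) * ((u : ℂ) - c + k ^ 2)))
      (Set.Ioi c) := by
    refine integrableOn_Ioi_of_norm_le (C := 1 / δ) hc (by fun_prop) fun u hu => ?_
    have hu0 : 0 < u := hc.trans hu
    have hs : 0 < √(u - c) := Real.sqrt_pos.2 (sub_pos.2 hu)
    have g := h z (Metric.mem_ball_self (by positivity)) u hu
    rw [hk, show (u : ℂ) - c + (z + c) = u + z by ring, norm_div, norm_one, norm_mul,
      Complex.norm_of_nonneg hs.le]
    calc 1 / (√(u - c) * ‖(u : ℂ) + z‖) ≤ 1 / (√(u - c) * (δ * u)) := by gcongr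
      _ = 1 / δ * (1 / (√(u - c) * u)) := by field_simp
  have hint₂ : IntegrableOn (fun u : ℝ => 1 / ((√(u - c) : ℂ) * √u * (√u + σ))) (Set.Ioi c) :=
    integrableOn_Ioi_of_norm_le (C := 1) hc (by fun_prop) fun u hu => by simpa using hrem u hu
  have key : (∫ u in Set.Ioi c, (√(1 - c / u) : ℂ) * (1 / ((u : ℂ) + a) - 1 / ((u : ℂ) + z))) -
      ∫ u in Set.Ioi c, (√(1 - c / u) : ℂ) * (1 / ((u : ℂ) + a) - 1 / ((u : ℂ) + -c)) =
      k ^ 2 / σ * (Real.pi / k - ∫ u in Set.Ioi c, 1 / ((√(u - c) : ℂ) * √u * (√u + σ))) := by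
    rw [← integral_inv_sqrt_sub_mul hkre hint₁, ← integral_sub hint₁ hint₂,
      ← integral_sub (integrableOn_dispersion hc ha hz) (integrableOn_dispersion_branch hc ha),
      ← integral_const_mul]
    refine setIntegral_congr_fun measurableSet_Ioi fun u hu => ?_
    have hu : c < u := hu
    have hu0 : 0 < u := hc.trans hu
    have hv : 0 < u - c := sub_pos.2 hu
    have hs : (√(u - c) : ℂ) ≠ 0 := by exact_mod_cast (Real.sqrt_pos.2 hv).ne'
    have hsu : (√u : ℂ) ≠ 0 := by exact_mod_cast (Real.sqrt_pos.2 hu0).ne'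
    have qs : (u : ℂ) - c = (√(u - c) : ℂ) ^ 2 := by
      rw [← ofReal_pow, Real.sq_sqrt hv.le, ofReal_sub]
    have qu : (u : ℂ) = (√u : ℂ) ^ 2 := by rw [← ofReal_pow, Real.sq_sqrt hu0.le]
    have n := ofReal_add_ne_zero hz hu
    have e : (u : ℂ) + z = (√u - σ) * (√u + σ) := by linear_combination qu + hσ
    have e' : (u : ℂ) - c + k ^ 2 = (√u - σ) * (√u + σ) := by linear_combination hk + e
    have n' := n
    rw [e] at n'
    have n₁ := left_ne_zero_of_mul n'
    have n₂ := right_ne_zero_of_mul n'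
    have ek : k ^ 2 = (√u - σ) * (√u + σ) - (√(u - c) : ℂ) ^ 2 := by linear_combination e' - qs
    rw [sqrt_one_sub_div hc hu, e', e, ← sub_eq_add_neg (u : ℂ) c, qs, ek]
    push_cast
    generalize (√(u - c) : ℂ) = s at *
    generalize (√u : ℂ) = t at *
    rw [← mul_sub, sub_sub_sub_cancel_left]
    field_simp
    ring
  have hbound : ‖∫ u in Set.Ioi c, 1 / ((√(u - c) : ℂ) * √u * (√u + σ))‖ ≤
      ∫ u in Set.Ioi c, 1 / (√(u - c) * u) := by
    refine norm_integral_le_of_norm_le (integrableOn_inv_sqrt_sub_mul hc) ?_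
    filter_upwards [ae_restrict_mem measurableSet_Ioi] with u hu using hrem u hu
  set H := ∫ u in Set.Ioi c, 1 / (√(u - c) * u)
  set J := ∫ u in Set.Ioi c, 1 / ((√(u - c) : ℂ) * √u * (√u + σ))
  have hkpos : 0 < ‖k‖ := norm_pos_iff.2 hk0
  have hH0 : 0 ≤ H := (norm_nonneg _).trans hbound
  rw [key, hnk, ← hk, norm_mul, norm_div, norm_pow]
  calc ‖k‖ ^ 2 / ‖σ‖ * ‖(Real.pi : ℂ) / k - J‖
      ≤ ‖k‖ ^ 2 / √(c / 2) * (‖(Real.pi : ℂ) / k‖ + H) := by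
        gcongr
        exact (norm_sub_le _ _).trans (by gcongr)
    _ = (Real.pi * ‖k‖ + ‖k‖ ^ 2 * H) / √(c / 2) := by
        rw [norm_div, Complex.norm_of_nonneg Real.pi_pos.le]
        field_simp

lemma add_mem_slitPlane_of_notMem_cutSet {m : ℝ} {z : ℂ} (hz : z ∉ cutSet m) :
    z + (4 * m ^ 2 : ℝ) ∈ slitPlane := by
  simp only [cutSet, Set.mem_ofPred_eq, not_and_or, not_le] at hz
  rw [mem_slitPlane_iff, add_re, add_im, ofReal_re, ofReal_im, add_zero]
  exact hz.symm.imp (fun h => by linarith) id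

theorem stmt_0 (m a : ℝ) (hm : 0 < m) (ha : -4 * m ^ 2 < a) :
    (∀ z ∈ (cutSet m)ᶜ, DifferentiableAt ℂ (Fa m a) z) ∧
    IntegrableOn (fun u : ℝ => (Real.sqrt (1 - 4 * m ^ 2 / u) : ℂ) *
      (1 / ((u : ℂ) + (a : ℂ)) - 1 / ((u : ℂ) + ((-4 * m ^ 2 : ℝ) : ℂ))))
      (Set.Ioi (4 * m ^ 2)) ∧
    ContinuousWithinAt (Fa m a) ((cutSet m)ᶜ ∪ {((-4 * m ^ 2 : ℝ) : ℂ)})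
      ((-4 * m ^ 2 : ℝ) : ℂ) := by
  have hc : 0 < 4 * m ^ 2 := by positivity
  have ha' : (a : ℂ) + (4 * m ^ 2 : ℝ) ∈ slitPlane := by
    rw [← ofReal_add, ofReal_mem_slitPlane]
    linarith
  rw [neg_mul, ofReal_neg]
  refine ⟨fun z hz => ?_, integrableOn_dispersion_branch hc ha', ?_⟩
  · exact differentiableAt_dispersion hc ha' (add_mem_slitPlane_of_notMem_cutSet hz)
  · set c : ℝ := 4 * m ^ 2
    rw [ContinuousWithinAt, tendsto_iff_norm_sub_tendsto_zero]
    set B : ℂ → ℝ := fun z => (Real.pi * √‖z + c‖ + ‖z + c‖ *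
      ∫ u in Set.Ioi c, 1 / (√(u - c) * u)) / √(c / 2) with hB
    have hBc : Continuous B := by fun_prop
    have hB0 : B (-c) = 0 := by simp [hB]
    have hBt : Tendsto B (𝓝[(cutSet m)ᶜ ∪ {-(c : ℂ)}] (-(c : ℂ))) (𝓝 0) := by
      rw [← hB0]
      exact hBc.continuousWithinAt
    refine squeeze_zero' (Eventually.of_forall fun _ => norm_nonneg _) ?_ hBt
    filter_upwards [self_mem_nhdsWithin,
      mem_nhdsWithin_of_mem_nhds (Metric.closedBall_mem_nhds (-(c : ℂ)) (half_pos hc))] with z hz hzc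
    rcases hz with hz | hz
    · rw [mem_closedBall_iff_norm, sub_neg_eq_add] at hzc
      exact norm_dispersion_sub_le hc ha' (add_mem_slitPlane_of_notMem_cutSet hz) hzc
    · rw [Set.mem_singleton_iff.1 hz, sub_self, norm_zero, hB0]
end

section
/- If a > 0, then for every complex z not in the half-line (-∞, 0] one has the closed form F_a(z) = 2·√((z + 4m²)/z)·log((√(z + 4m²) + √z)/(2m)) − 2·√((a + 4m²)/a)·log((√(a + 4m²) + √a)/(2m)), where √ and log denote the principal branches. -/
open MeasureTheory Complex Filter

/-- The principal square root of a number off `(-∞, 0]` has positive real part. -/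
lemma re_cpow_half_pos {z : ℂ} (hz : z ∈ slitPlane) : 0 < (z ^ ((1 : ℂ) / 2)).re := by
  have hz0 : z ≠ 0 := slitPlane_ne_zero hz
  have harg : z.arg ≠ Real.pi := slitPlane_arg_ne_pi hz
  rw [cpow_def_of_ne_zero hz0, exp_re]
  refine mul_pos (Real.exp_pos _) (Real.cos_pos_of_mem_Ioo ?_)
  have him : (log z * (1 / 2)).im = z.arg / 2 := by
    rw [mul_one_div, show (2 : ℂ) = ((2 : ℝ) : ℂ) by norm_num, div_ofReal_im, log_im]
  rw [him]
  constructor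
  · linarith [neg_pi_lt_arg z]
  · linarith [lt_of_le_of_ne (arg_le_pi z) harg]

lemma cpow_half_sq (z : ℂ) : (z ^ ((1 : ℂ) / 2)) ^ 2 = z := by
  rw [one_div]
  exact cpow_ofNat_inv_pow z 2

/-- If `v² - w²` is a positive real and `v`, `w` lie in the right half-plane, so does `v - w`. -/
lemma re_sub_pos_of_sq_sub_sq {v w : ℂ} {c : ℝ} (hc : 0 < c) (hv : 0 < v.re) (hw : 0 < w.re)
    (h : v ^ 2 - w ^ 2 = c) : 0 < (v - w).re := by
  have hre : 0 < (v + w).re := by simpa using add_pos hv hw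
  have hne : v + w ≠ 0 := by
    intro h0
    simp [h0] at hre
  have heq : v - w = c * (v + w)⁻¹ := by
    field_simp
    linear_combination h
  rw [heq, re_ofReal_mul, inv_re]
  exact mul_pos hc (div_pos hre (normSq_pos.mpr hne))

/-- If `v² - w²` is real and `v`, `w` lie in the right half-plane, so does `v / w`. -/
lemma re_div_pos_of_sq_sub_sq {v w : ℂ} {c : ℝ} (hv : 0 < v.re) (hw : 0 < w.re)
    (h : v ^ 2 - w ^ 2 = c) : 0 < (v / w).re := by
  have hne : w ≠ 0 := by
    rintro rfl
    simp at hw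
  have him : v.re * v.im = w.re * w.im := by
    have := congrArg Complex.im h
    simp [pow_two] at this
    linarith
  have hnn : 0 ≤ v.im * w.im := by
    have hprod : 0 ≤ (v.re * w.re) * (v.im * w.im) := by
      have : (v.re * w.re) * (v.im * w.im) = (w.re * w.im) ^ 2 := by
        linear_combination w.re * w.im * him
      rw [this]
      positivity
    exact nonneg_of_mul_nonneg_right hprod (mul_pos hv hw)
  have hpos := normSq_pos.mpr hne
  rw [div_re, ← add_div]
  exact div_pos (by linarith [mul_pos hv hw]) hpos

/-- The conjugate pair `v + w`, `v - w` with product `4m²` has logarithms symmetric about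
`log (2m)`. -/
lemma log_add_sub_log_sub {v w : ℂ} {m : ℝ} (hm : 0 < m) (hv : 0 < v.re) (hw : 0 < w.re)
    (h : v ^ 2 - w ^ 2 = 4 * (m : ℂ) ^ 2) :
    log (v + w) - log (v - w) = 2 * log ((v + w) / (2 * m)) := by
  have hre : 0 < (v + w).re := by simpa using add_pos hv hw
  have hne : v + w ≠ 0 := by
    intro h0
    simp [h0] at hre
  have hmC : (m : ℂ) ≠ 0 := by exact_mod_cast hm.ne'
  have heq : v - w = ((2 * m : ℝ) : ℂ) * (((2 * m : ℝ) : ℂ) * (v + w)⁻¹) := by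
    push_cast
    field_simp
    linear_combination h
  have hdiv : (v + w) / (2 * m) = (((2 * m)⁻¹ : ℝ) : ℂ) * (v + w) := by
    push_cast
    field_simp
  have h2m : 0 < 2 * m := by positivity
  have h2mC : ((2 * m : ℝ) : ℂ) ≠ 0 := by exact_mod_cast h2m.ne'
  rw [hdiv, log_ofReal_mul (inv_pos.mpr h2m) hne, heq,
    log_ofReal_mul h2m (mul_ne_zero h2mC (inv_ne_zero hne)),
    log_ofReal_mul h2m (inv_ne_zero hne),
    log_inv _ (slitPlane_arg_ne_pi (Or.inl hre)), Real.log_inv]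
  push_cast
  ring

lemma re_sub_mul_pos {v w : ℂ} (hv : 0 < v.re) (hvw : 0 < (v - w).re) {s : ℝ} (hs0 : 0 ≤ s)
    (hs1 : s ≤ 1) : 0 < (v - s * w).re := by
  simp only [sub_re, re_ofReal_mul] at hvw ⊢
  rcases hs1.lt_or_eq with h | rfl
  · nlinarith [mul_nonneg hs0 hvw.le, mul_pos (sub_pos.mpr h) hv]
  · simpa using hvw

lemma one_sub_div_pos {c u : ℝ} (hc : 0 < c) (hu : c < u) : 0 < 1 - c / u := by
  rw [sub_pos, div_lt_one (hc.trans hu)]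
  exact hu

lemma sqrt_one_sub_div_sq_mul {c u : ℝ} (hc : 0 < c) (hu : c < u) :
    (Real.sqrt (1 - c / u) : ℂ) ^ 2 * u = u - c := by
  have huC : (u : ℂ) ≠ 0 := by exact_mod_cast (hc.trans hu).ne'
  rw [← ofReal_pow, Real.sq_sqrt (one_sub_div_pos hc hu).le]
  push_cast
  field_simp

lemma hasDerivAt_sqrt_one_sub_div {c u : ℝ} (hc : 0 < c) (hu : c < u) :
    HasDerivAt (fun u : ℝ => Real.sqrt (1 - c / u))
      (c / u ^ 2 / (2 * Real.sqrt (1 - c / u))) u := by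
  have hu0 : u ≠ 0 := (hc.trans hu).ne'
  have hpos := one_sub_div_pos hc hu
  have h := (((hasDerivAt_inv hu0).const_mul c).const_sub 1)
  have h' : HasDerivAt (fun u : ℝ => 1 - c / u) (c / u ^ 2) u := by
    convert! h using 1
    ring
  exact h'.sqrt hpos.ne'

lemma tendsto_sqrt_one_sub_div (c : ℝ) :
    Tendsto (fun u : ℝ => Real.sqrt (1 - c / u)) atTop (nhds 1) := by
  have h : Tendsto (fun u : ℝ => 1 - c / u) atTop (nhds (1 - 0)) :=
    tendsto_const_nhds.sub (tendsto_const_nhds.div_atTop tendsto_id)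
  simpa using h.sqrt

lemma continuousWithinAt_sqrt_one_sub_div {c : ℝ} (hc : 0 < c) :
    ContinuousWithinAt (fun u : ℝ => Real.sqrt (1 - c / u)) (Set.Ici c) c :=
  ((continuousAt_const.sub (continuousAt_const.div continuousAt_id hc.ne')).sqrt).continuousWithinAt

lemma integrableOn_deriv_sqrt_one_sub_div {c : ℝ} (hc : 0 < c) :
    IntegrableOn (fun u : ℝ => c / u ^ 2 / (2 * Real.sqrt (1 - c / u))) (Set.Ioi c) :=
  integrableOn_Ioi_deriv_of_nonneg (continuousWithinAt_sqrt_one_sub_div hc)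
    (fun _ hu => hasDerivAt_sqrt_one_sub_div hc hu) (fun _ _ => by positivity)
    (tendsto_sqrt_one_sub_div c)

/-- Along `s = √(1 - c/u)` the function `(v/w)·(log (v + s w) - log (v - s w))` is an
antiderivative of an integrable function, with increment given by its value at `s = 1`. -/
lemma integrableOn_and_integral_of_sq {v w z : ℂ} {c : ℝ} (hc : 0 < c) (hv : 0 < v.re)
    (hw : 0 < w.re) (hvz : v ^ 2 = z + c) (hwz : w ^ 2 = z) :
    IntegrableOn (fun u : ℝ => (z + c) / (u * (Real.sqrt (1 - c / u) : ℂ) * (u + z)))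
      (Set.Ioi c) ∧
    ∫ u in Set.Ioi c, (z + c) / (u * (Real.sqrt (1 - c / u) : ℂ) * (u + z)) =
      v / w * (log (v + w) - log (v - w)) := by
  have hvw : 0 < (v - w).re :=
    re_sub_pos_of_sq_sub_sq hc hv hw (by rw [hvz, hwz]; ring)
  have hplus : ∀ s : ℝ, 0 ≤ s → 0 < (v + s * w).re := fun s hs => by
    simp only [add_re, re_ofReal_mul]
    positivity
  have hminus : ∀ s : ℝ, 0 ≤ s → s ≤ 1 → 0 < (v - s * w).re := fun s h0 h1 =>
    re_sub_mul_pos hv hvw h0 h1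
  have ne_of_re : ∀ x : ℂ, 0 < x.re → x ≠ 0 := by
    rintro x hx rfl
    simp at hx
  have hw0 := ne_of_re w hw
  set L : ℝ → ℂ := fun s => v / w * (log (v + s * w) - log (v - s * w)) with hL
  set D : ℝ → ℂ := fun s => v / (v + s * w) + v / (v - s * w) with hD
  have hLD : ∀ s : ℝ, 0 ≤ s → s ≤ 1 → HasDerivAt L (D s) s := by
    intro s h0 h1
    have hsw : HasDerivAt (fun s : ℝ => (s : ℂ) * w) w s := by
      simpa using (ofRealCLM.hasDerivAt (x := s)).mul_const w
    have hp := (hsw.const_add v).clog_real (Or.inl (hplus s h0))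
    have hq := (hsw.const_sub v).clog_real (Or.inl (hminus s h0 h1))
    have hp0 := ne_of_re _ (hplus s h0)
    have hq0 := ne_of_re _ (hminus s h0 h1)
    convert! (hp.sub hq).const_mul (v / w) using 1
    simp only [hD]
    field_simp
    ring
  have hDcont : ContinuousOn D (Set.Icc 0 1) := by
    refine ContinuousOn.add ?_ ?_
    · exact continuousOn_const.div (by fun_prop) fun s hs => ne_of_re _ (hplus s hs.1)
    · exact continuousOn_const.div (by fun_prop) fun s hs => ne_of_re _ (hminus s hs.1 hs.2)
  obtain ⟨C, hC⟩ := isCompact_Icc.exists_bound_of_continuousOn hDcont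
  have hs1 : ∀ u ∈ Set.Ioi c, Real.sqrt (1 - c / u) ≤ 1 := fun u hu => by
    refine Real.sqrt_le_one.mpr ?_
    have : 0 ≤ c / u := div_nonneg hc.le (hc.trans hu).le
    linarith
  have hderiv_eq : ∀ u ∈ Set.Ioi c,
      ((c / u ^ 2 / (2 * Real.sqrt (1 - c / u)) : ℝ) : ℂ) * D (Real.sqrt (1 - c / u)) =
        (z + c) / (u * (Real.sqrt (1 - c / u) : ℂ) * (u + z)) := by
    intro u hu
    have hu0 : 0 < u := hc.trans hu
    have hpos := one_sub_div_pos hc hu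
    have hsq := sqrt_one_sub_div_sq_mul hc hu
    have hs0 : ((Real.sqrt (1 - c / u) : ℝ) : ℂ) ≠ 0 := by
      exact_mod_cast (Real.sqrt_pos.mpr hpos).ne'
    have hp0 := ne_of_re _ (hplus _ (Real.sqrt_nonneg (1 - c / u)))
    have hq0 := ne_of_re _ (hminus _ (Real.sqrt_nonneg (1 - c / u)) (hs1 u hu))
    have huC : (u : ℂ) ≠ 0 := by exact_mod_cast hu0.ne'
    have hcC : (c : ℂ) ≠ 0 := by exact_mod_cast hc.ne'
    simp only [hD]
    push_cast
    generalize ((Real.sqrt (1 - c / u) : ℝ) : ℂ) = s at *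
    have hprod : (v + s * w) * (v - s * w) * u = c * (u + z) := by
      linear_combination u * hvz - s ^ 2 * u * hwz - z * hsq
    have huz : (u : ℂ) + z ≠ 0 := by
      intro h0
      rw [h0, mul_zero] at hprod
      exact mul_ne_zero (mul_ne_zero hp0 hq0) huC hprod
    have hsum : v / (v + s * w) + v / (v - s * w) = 2 * (z + c) * u / (c * (u + z)) := by
      rw [← hprod, ← hvz]
      field_simp
      ring
    rw [hsum]
    field_simp
  have hint : IntegrableOn (fun u : ℝ => (z + c) / (u * (Real.sqrt (1 - c / u) : ℂ) * (u + z)))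
      (Set.Ioi c) := by
    refine ((integrableOn_deriv_sqrt_one_sub_div hc).mul_const C).mono' ?_ ?_
    · exact Measurable.aestronglyMeasurable (by fun_prop)
    · refine (ae_restrict_iff' measurableSet_Ioi).mpr (ae_of_all _ fun u hu => ?_)
      rw [← hderiv_eq u hu, norm_mul, norm_real, Real.norm_of_nonneg (by positivity)]
      gcongr
      exact hC _ ⟨Real.sqrt_nonneg _, hs1 u hu⟩
  refine ⟨hint, ?_⟩
  have hcont : ContinuousWithinAt (fun u : ℝ => L (Real.sqrt (1 - c / u))) (Set.Ici c) c := by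
    have hLc : ContinuousAt L (Real.sqrt (1 - c / c)) := by
      rw [div_self hc.ne', sub_self, Real.sqrt_zero]
      exact (hLD 0 le_rfl zero_le_one).continuousAt
    exact ContinuousAt.comp_continuousWithinAt (f := fun u : ℝ => Real.sqrt (1 - c / u)) hLc
      (continuousWithinAt_sqrt_one_sub_div hc)
  have htend : Tendsto (fun u : ℝ => L (Real.sqrt (1 - c / u))) atTop (nhds (L 1)) :=
    (hLD 1 zero_le_one le_rfl).continuousAt.tendsto.comp (tendsto_sqrt_one_sub_div c)
  have hderiv : ∀ u ∈ Set.Ioi c, HasDerivAt (fun u : ℝ => L (Real.sqrt (1 - c / u)))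
      ((z + c) / (u * (Real.sqrt (1 - c / u) : ℂ) * (u + z))) u := by
    intro u hu
    rw [← hderiv_eq u hu, ← real_smul]
    exact (hLD _ (Real.sqrt_nonneg _) (hs1 u hu)).scomp u (hasDerivAt_sqrt_one_sub_div hc hu)
  rw [integral_Ioi_of_hasDerivAt_of_tendsto hcont hderiv hint htend]
  simp [hL, hc.ne']

lemma integrableOn_and_integral_closed_form {m : ℝ} (hm : 0 < m) {z : ℂ} (hz : z ∈ slitPlane) :
    IntegrableOn (fun u : ℝ => (z + (4 * m ^ 2 : ℝ)) /
      (u * (Real.sqrt (1 - 4 * m ^ 2 / u) : ℂ) * (u + z))) (Set.Ioi (4 * m ^ 2)) ∧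
    ∫ u in Set.Ioi (4 * m ^ 2), (z + (4 * m ^ 2 : ℝ)) /
      (u * (Real.sqrt (1 - 4 * m ^ 2 / u) : ℂ) * (u + z)) =
      2 * ((z + 4 * (m : ℂ) ^ 2) / z) ^ ((1 : ℂ) / 2) *
        log (((z + 4 * (m : ℂ) ^ 2) ^ ((1 : ℂ) / 2) + z ^ ((1 : ℂ) / 2)) / (2 * m)) := by
  have hc : 0 < 4 * m ^ 2 := by positivity
  have hcast : ((4 * m ^ 2 : ℝ) : ℂ) = 4 * (m : ℂ) ^ 2 := by push_cast; rfl
  have hzc : z + 4 * (m : ℂ) ^ 2 ∈ slitPlane := by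
    rw [← hcast]
    rcases hz with h | h
    · left
      simp only [add_re, ofReal_re]
      positivity
    · right
      simpa only [add_im, ofReal_im, add_zero] using h
  have hv := re_cpow_half_pos hzc
  have hw := re_cpow_half_pos hz
  have hvz := cpow_half_sq (z + 4 * (m : ℂ) ^ 2)
  have hwz := cpow_half_sq z
  have hquot : ((z + 4 * (m : ℂ) ^ 2) / z) ^ ((1 : ℂ) / 2) =
      (z + 4 * (m : ℂ) ^ 2) ^ ((1 : ℂ) / 2) / z ^ ((1 : ℂ) / 2) := by
    have hre := re_div_pos_of_sq_sub_sq (c := 4 * m ^ 2) hv hw (by rw [hvz, hwz, hcast]; ring)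
    have h := sq_cpow_two_inv hre
    rwa [div_pow, hvz, hwz, ← one_div] at h
  obtain ⟨hint, hval⟩ := integrableOn_and_integral_of_sq hc hv hw (hvz.trans (by rw [hcast])) hwz
  refine ⟨hint, hval.trans ?_⟩
  rw [hquot, log_add_sub_log_sub hm hv hw (by rw [hvz, hwz]; ring)]
  ring

/-- The integrand of `Fa` differs from the closed-form integrand only by the `z`-independent
function `1 / (u √(1 - c/u))`. -/
lemma sqrt_div_add_eq {c u : ℝ} (hc : 0 < c) (hu : c < u) {z : ℂ} (hz : z ∈ slitPlane) :
    (Real.sqrt (1 - c / u) : ℂ) * (1 / (u + z)) = 1 / (u * (Real.sqrt (1 - c / u) : ℂ)) -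
      (z + c) / (u * (Real.sqrt (1 - c / u) : ℂ) * (u + z)) := by
  have hu0 : 0 < u := hc.trans hu
  have hpos := one_sub_div_pos hc hu
  have huC : (u : ℂ) ≠ 0 := by exact_mod_cast hu0.ne'
  have hsq : ((Real.sqrt (1 - c / u) : ℝ) : ℂ) ^ 2 * u = u - c := by
    rw [← ofReal_pow, Real.sq_sqrt hpos.le]
    push_cast
    field_simp
  have hs0 : ((Real.sqrt (1 - c / u) : ℝ) : ℂ) ≠ 0 := by
    exact_mod_cast (Real.sqrt_pos.mpr hpos).ne'
  have huz : (u : ℂ) + z ≠ 0 := by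
    refine slitPlane_ne_zero ?_
    rcases hz with h | h
    · left
      simp only [add_re, ofReal_re]
      positivity
    · right
      simpa only [add_im, ofReal_im, zero_add] using h
  generalize ((Real.sqrt (1 - c / u) : ℝ) : ℂ) = s at *
  field_simp
  linear_combination hsq

theorem stmt_4 (m a : ℝ) (hm : 0 < m) (ha : 0 < a) :
    ∀ z : ℂ, (z.im ≠ 0 ∨ 0 < z.re) →
      Fa m a z =
        2 * ((z + 4 * (m : ℂ) ^ 2) / z) ^ ((1 : ℂ) / 2) *
          Complex.log (((z + 4 * (m : ℂ) ^ 2) ^ ((1 : ℂ) / 2) + z ^ ((1 : ℂ) / 2)) / (2 * m)) -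
        2 * (((a : ℂ) + 4 * (m : ℂ) ^ 2) / (a : ℂ)) ^ ((1 : ℂ) / 2) *
          Complex.log ((((a : ℂ) + 4 * (m : ℂ) ^ 2) ^ ((1 : ℂ) / 2) + (a : ℂ) ^ ((1 : ℂ) / 2)) /
            (2 * m)) := by
  intro z hz
  have hz' : z ∈ slitPlane := mem_slitPlane_iff.mpr hz.symm
  have ha' : (a : ℂ) ∈ slitPlane := Or.inl (by simpa using ha)
  obtain ⟨hzi, hzv⟩ := integrableOn_and_integral_closed_form hm hz'
  obtain ⟨hai, hav⟩ := integrableOn_and_integral_closed_form hm ha'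
  rw [← hzv, ← hav, ← integral_sub hzi hai, Fa]
  refine setIntegral_congr_fun measurableSet_Ioi fun u hu => ?_
  have hc : 0 < 4 * m ^ 2 := by positivity
  simp only [mul_sub, sqrt_div_add_eq hc hu hz', sqrt_div_add_eq hc hu ha']
  ring
end

section
/- Let m > 0, let f : ℝ → ℂ be a Schwartz function, and for t > 0 define W(t) = ∫_0^∞ f(p) · e^{i√(p² + m²) t} · (p²/√(p² + m²)) dp. Then the limit lim_{t→∞} t^{3/2} · e^{−imt} · W(t) exists and equals f(0) · √(2m) · (√π / 2) · e^{3πi/4}; in particular there is a constant C with |W(t)| ≤ C · t^{−3/2} for all t ≥ 1. -/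
open MeasureTheory Complex Filter

/-- The massive oscillatory integral `W(t) = ∫_0^∞ f(p) e^{i√(p²+m²)t} p²/√(p²+m²) dp`. -/
noncomputable def Wt (m : ℝ) (f : SchwartzMap ℝ ℂ) (t : ℝ) : ℂ :=
  ∫ p in Set.Ioi (0 : ℝ),
    f p * Complex.exp (Complex.I * (Real.sqrt (p ^ 2 + m ^ 2) : ℂ) * t) *
      ((p ^ 2 : ℂ) / (Real.sqrt (p ^ 2 + m ^ 2) : ℂ))

open Set Topology

/-- The complex Fresnel integral `∫_0^x e^{iy²} dy`. -/
noncomputable def fresnel (x : ℝ) : ℂ := ∫ y in (0 : ℝ)..x, cexp (I * (y : ℂ) ^ 2)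

lemma continuous_cexp_I_mul_sq : Continuous fun y : ℝ => cexp (I * (y : ℂ) ^ 2) := by fun_prop

lemma norm_cexp_I_mul_sq (y : ℝ) : ‖cexp (I * (y : ℂ) ^ 2)‖ = 1 := by
  rw [mul_comm, ← ofReal_pow, norm_exp_ofReal_mul_I]

lemma norm_cexp_I_mul_mul (x y : ℝ) : ‖cexp (I * (x : ℂ) * y)‖ = 1 := by
  rw [mul_assoc, mul_comm, ← ofReal_mul, norm_exp_ofReal_mul_I]

lemma hasDerivAt_fresnel (x : ℝ) : HasDerivAt fresnel (cexp (I * (x : ℂ) ^ 2)) x :=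
  continuous_cexp_I_mul_sq.integral_hasStrictDerivAt 0 x |>.hasDerivAt

lemma continuous_fresnel : Continuous fresnel :=
  continuous_iff_continuousAt.2 fun x => (hasDerivAt_fresnel x).continuousAt

lemma exists_tendsto_fresnel : ∃ L, Tendsto fresnel atTop (𝓝 L) := by
  let g : ℝ → ℂ := fun y => cexp (I * (y : ℂ) ^ 2) * ((y ^ (-2 : ℝ) : ℝ) : ℂ) / (2 * I)
  let G : ℝ → ℂ := fun y => cexp (I * (y : ℂ) ^ 2) * ((y⁻¹ : ℝ) : ℂ) / (2 * I)
  have hg_cont : ContinuousOn g (Ioi 0) := by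
    have : ContinuousOn (fun y : ℝ => y ^ (-2 : ℝ)) (Ioi 0) :=
      continuousOn_id.rpow_const fun y hy => Or.inl (ne_of_gt hy)
    have h2 : ContinuousOn (fun y : ℝ => ((y ^ (-2 : ℝ) : ℝ) : ℂ)) (Ioi 0) :=
      continuous_ofReal.comp_continuousOn this
    exact (continuous_cexp_I_mul_sq.continuousOn.mul h2).div_const _
  have hg_int : IntegrableOn g (Ioi 1) := by
    have h := (integrableOn_Ioi_rpow_of_lt (show (-2 : ℝ) < -1 by norm_num) one_pos)
    refine Integrable.mono h
      ((hg_cont.mono (Ioi_subset_Ioi zero_le_one)).aestronglyMeasurable measurableSet_Ioi) ?_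
    refine Eventually.of_forall fun y => ?_
    simp only [g, norm_div, norm_mul, norm_cexp_I_mul_sq, norm_real, norm_I, Complex.norm_ofNat]
    linarith [norm_nonneg (y ^ (-2 : ℝ))]
  have hG : ∀ y : ℝ, 0 < y → HasDerivAt G (cexp (I * (y : ℂ) ^ 2) - g y) y := by
    intro y hy
    have hy' : (y : ℂ) ≠ 0 := by exact_mod_cast hy.ne'
    have h1 : HasDerivAt (fun y : ℝ => cexp (I * (y : ℂ) ^ 2))
        (cexp (I * (y : ℂ) ^ 2) * (I * (2 * y))) y := by
      have := ((((hasDerivAt_id (y : ℂ)).pow 2).const_mul I).cexp).comp_ofReal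
      simpa using this
    have h2 := (hasDerivAt_inv hy.ne').ofReal_comp
    refine ((h1.mul h2).div_const (2 * I)).congr_deriv ?_
    simp only [g]
    rw [Real.rpow_neg hy.le, Real.rpow_two]
    push_cast
    field_simp
    ring
  have hG_lim : Tendsto G atTop (𝓝 0) := by
    rw [tendsto_zero_iff_norm_tendsto_zero]
    have h := (tendsto_inv_atTop_zero (𝕜 := ℝ)).norm.div_const 2
    rw [norm_zero, zero_div] at h
    refine h.congr fun y => ?_
    simp only [G, norm_div, norm_mul, norm_cexp_I_mul_sq, norm_real, norm_I, Complex.norm_ofNat]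
    ring
  have key : ∀ x : ℝ, 1 ≤ x →
      fresnel 1 + (G x - G 1) + ∫ y in (1 : ℝ)..x, g y = fresnel x := by
    intro x hx
    have hsub : uIcc 1 x ⊆ Ioi (0 : ℝ) := by
      rw [uIcc_of_le hx]
      exact fun y hy => zero_lt_one.trans_le hy.1
    have hgi : IntervalIntegrable g volume 1 x := (hg_cont.mono hsub).intervalIntegrable
    have hei : ∀ a b : ℝ, IntervalIntegrable (fun y : ℝ => cexp (I * (y : ℂ) ^ 2)) volume a b :=
      fun a b => continuous_cexp_I_mul_sq.intervalIntegrable a b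
    have h := intervalIntegral.integral_eq_sub_of_hasDerivAt
      (fun y hy => hG y (hsub hy)) ((hei 1 x).sub hgi)
    rw [intervalIntegral.integral_sub (hei 1 x) hgi] at h
    rw [← h, fresnel, fresnel, ← intervalIntegral.integral_add_adjacent_intervals
      (hei 0 1) (hei 1 x)]
    ring
  refine ⟨fresnel 1 + (0 - G 1) + ∫ y in Ioi (1 : ℝ), g y, ?_⟩
  refine (((hG_lim.sub_const (G 1)).const_add (fresnel 1)).add
    (intervalIntegral_tendsto_integral_Ioi 1 hg_int tendsto_id)).congr' ?_
  filter_upwards [eventually_ge_atTop 1] with x hx using key x hx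

lemma exists_norm_fresnel_le : ∃ B, ∀ x, 0 ≤ x → ‖fresnel x‖ ≤ B := by
  obtain ⟨L, hL⟩ := exists_tendsto_fresnel
  obtain ⟨T, hT⟩ := eventually_atTop.1 (hL.norm.eventually_le_const (lt_add_one ‖L‖))
  obtain ⟨B, hB⟩ := (isCompact_Icc (a := (0 : ℝ)) (b := T)).exists_bound_of_continuousOn
    continuous_fresnel.continuousOn
  refine ⟨max B (‖L‖ + 1), fun x hx => ?_⟩
  rcases le_total x T with h | h
  · exact (hB x ⟨hx, h⟩).trans (le_max_left _ _)
  · exact (hT x h).trans (le_max_right _ _)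

/-- Leading-order stationary phase at the endpoint of a half-line, for the phase `s²`. -/
lemma tendsto_sqrt_mul_integral_of_tendsto_fresnel {L : ℂ} (hL : Tendsto fresnel atTop (𝓝 L))
    {φ φ' : ℝ → ℂ} {s s' : ℝ → ℝ} (hφ : ∀ x, HasDerivAt φ (φ' x) x)
    (hs : ∀ x, HasDerivAt s (s' x) x) (hs_zero : s 0 = 0) (hs_pos : ∀ x, 0 < x → 0 < s x)
    (hφ' : IntegrableOn φ' (Ioi 0)) (hφ_lim : Tendsto φ atTop (𝓝 0))
    (hφs : IntegrableOn (fun x => φ x * s' x) (Ioi 0)) :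
    Tendsto (fun t : ℝ => (√t : ℂ) * ∫ x in Ioi (0 : ℝ), φ x * s' x * cexp (I * t * (s x : ℂ) ^ 2))
      atTop (𝓝 (φ 0 * L)) := by
  obtain ⟨B, hB⟩ := exists_norm_fresnel_le
  have hs_cont : Continuous s := continuous_iff_continuousAt.2 fun x => (hs x).continuousAt
  have hφ_cont : Continuous φ := continuous_iff_continuousAt.2 fun x => (hφ x).continuousAt
  have hv_cont : ∀ t : ℝ, Continuous fun x => fresnel (√t * s x) := fun t =>
    continuous_fresnel.comp (continuous_const.mul hs_cont)
  have hv_bound : ∀ t x : ℝ, 0 < x → ‖fresnel (√t * s x)‖ ≤ B := fun t x hx =>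
    hB _ (mul_nonneg (Real.sqrt_nonneg _) (hs_pos x hx).le)
  have hφ'v : ∀ t : ℝ, IntegrableOn (fun x => φ' x * fresnel (√t * s x)) (Ioi 0) := by
    intro t
    refine Integrable.mul_bdd (c := B) hφ' (hv_cont t).aestronglyMeasurable ?_
    filter_upwards [ae_restrict_mem measurableSet_Ioi] with x hx using hv_bound t x hx
  have hparts : ∀ t : ℝ, 0 < t →
      (√t : ℂ) * ∫ x in Ioi (0 : ℝ), φ x * s' x * cexp (I * t * (s x : ℂ) ^ 2) =
        -∫ x in Ioi (0 : ℝ), φ' x * fresnel (√t * s x) := by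
    intro t ht
    have hexp : ∀ x, cexp (I * ((√t * s x : ℝ) : ℂ) ^ 2) = cexp (I * t * (s x : ℂ) ^ 2) := by
      intro x
      congr 1
      have : ((√t : ℝ) : ℂ) ^ 2 = t := by exact_mod_cast Real.sq_sqrt ht.le
      push_cast
      rw [mul_pow, this, mul_assoc]
    have hv : ∀ x, HasDerivAt (fun x => fresnel (√t * s x))
        ((√t : ℂ) * s' x * cexp (I * t * (s x : ℂ) ^ 2)) x := by
      intro x
      have := (hasDerivAt_fresnel (√t * s x)).scomp x ((hs x).const_mul (√t))
      rw [hexp] at this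
      refine this.congr_deriv ?_
      rw [real_smul]
      push_cast
      ring
    have hexp_norm : ∀ x, ‖cexp (I * t * (s x : ℂ) ^ 2)‖ ≤ 1 := fun x => by
      rw [← hexp]; exact (norm_cexp_I_mul_sq _).le
    have hφv' : IntegrableOn
        (φ * fun x => (√t : ℂ) * s' x * cexp (I * t * (s x : ℂ) ^ 2)) (Ioi 0) := by
      have h1 : IntegrableOn (fun x => φ x * s' x * cexp (I * t * (s x : ℂ) ^ 2)) (Ioi 0) :=
        Integrable.mul_bdd (c := 1) hφs (by fun_prop) (Eventually.of_forall hexp_norm)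
      refine (h1.const_mul (√t : ℂ)).congr (Eventually.of_forall fun x => ?_)
      simp only [Pi.mul_apply]
      ring
    have h_zero : Tendsto (φ * fun x => fresnel (√t * s x)) (𝓝[>] 0) (𝓝 0) := by
      have h := (hφ_cont.mul (hv_cont t)).tendsto 0
      rw [show (φ * fun x => fresnel (√t * s x)) 0 = 0 by simp [hs_zero, fresnel]] at h
      exact h.mono_left nhdsWithin_le_nhds
    have h_infty : Tendsto (φ * fun x => fresnel (√t * s x)) atTop (𝓝 0) := by
      refine hφ_lim.zero_mul_isBoundedUnder_le ⟨B, ?_⟩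
      rw [eventually_map]
      filter_upwards [eventually_gt_atTop 0] with x hx using hv_bound t x hx
    have h := integral_Ioi_mul_deriv_eq_deriv_mul (fun x _ => hφ x) (fun x _ => hv x) hφv'
      (hφ'v t) h_zero h_infty
    rw [sub_zero, zero_sub] at h
    rw [← h, ← integral_const_mul]
    congr 1 with x
    ring
  have hlim : Tendsto (fun t : ℝ => ∫ x in Ioi (0 : ℝ), φ' x * fresnel (√t * s x)) atTop
      (𝓝 (∫ x in Ioi (0 : ℝ), φ' x * L)) := by
    refine tendsto_integral_filter_of_dominated_convergence (fun x => ‖φ' x‖ * B)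
      (Eventually.of_forall fun t => (hφ'v t).aestronglyMeasurable) ?_ (hφ'.norm.mul_const B) ?_
    · refine Eventually.of_forall fun t => ?_
      filter_upwards [ae_restrict_mem measurableSet_Ioi] with x hx
      rw [norm_mul]
      exact mul_le_mul_of_nonneg_left (hv_bound t x hx) (norm_nonneg _)
    · filter_upwards [ae_restrict_mem measurableSet_Ioi] with x hx
      exact (hL.comp (Real.tendsto_sqrt_atTop.atTop_mul_const (hs_pos x hx))).const_mul _
  have hval : ∫ x in Ioi (0 : ℝ), φ' x * L = -(φ 0 * L) := by
    rw [integral_mul_const, integral_Ioi_of_hasDerivAt_of_tendsto' (fun x _ => hφ x) hφ' hφ_lim]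
    ring
  rw [hval] at hlim
  have := hlim.neg
  rw [neg_neg] at this
  refine this.congr' ?_
  filter_upwards [eventually_gt_atTop 0] with t ht using (hparts t ht).symm

lemma tendsto_sqrt_mul_gaussian_integral :
    Tendsto (fun t : ℝ => (√t : ℂ) * ∫ x in Ioi (0 : ℝ), cexp (-(1 - I * t) * (x : ℂ) ^ 2))
      atTop (𝓝 (((√Real.pi / 2 : ℝ) : ℂ) * cexp (Real.pi * I / 4))) := by
  have hre : ∀ t : ℝ, (1 - I * t).re = 1 := fun t => by simp
  have hslit : (Real.pi * I : ℂ) ∈ slitPlane := by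
    rw [mem_slitPlane_iff]; right; simp [Real.pi_ne_zero]
  have hval : (Real.pi * I : ℂ) ^ (1 / 2 : ℂ) / 2 =
      ((√Real.pi / 2 : ℝ) : ℂ) * cexp (Real.pi * I / 4) := by
    rw [cpow_def_of_ne_zero (by simp [Real.pi_ne_zero]),
      log_ofReal_mul Real.pi_pos I_ne_zero, log_I, add_mul, Complex.exp_add,
      Real.sqrt_eq_rpow, Real.rpow_def_of_pos Real.pi_pos]
    push_cast
    ring_nf
  rw [← hval]
  have hlim : Tendsto (fun t : ℝ => (Real.pi / ((t⁻¹ : ℝ) - I) : ℂ)) atTop (𝓝 (Real.pi * I)) := by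
    have h0 : Tendsto (fun t : ℝ => ((t⁻¹ : ℝ) : ℂ)) atTop (𝓝 0) := by
      exact (continuous_ofReal.tendsto' 0 0 ofReal_zero).comp tendsto_inv_atTop_zero
    have h := (tendsto_const_nhds (x := (Real.pi : ℂ))).div (h0.sub_const I) (by simp)
    simpa [div_eq_mul_inv, Pi.mul_def, Pi.inv_def] using h
  refine ((hlim.cpow tendsto_const_nhds hslit).div_const 2).congr' ?_
  filter_upwards [eventually_gt_atTop 0] with t ht
  have ht' : (t : ℂ) ≠ 0 := by exact_mod_cast ht.ne'
  have hne : (1 - I * t : ℂ) ≠ 0 := fun h => by simpa [hre] using congrArg re h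
  have hq : (Real.pi / (1 - I * t) : ℂ) ≠ 0 := div_ne_zero (by simp [Real.pi_ne_zero]) hne
  have heq : (Real.pi / ((t⁻¹ : ℝ) - I) : ℂ) = t * (Real.pi / (1 - I * t)) := by
    have : ((t⁻¹ : ℝ) - I : ℂ) = (1 - I * t) / t := by
      push_cast; field_simp
    rw [this]; field_simp
  rw [integral_gaussian_complex_Ioi (by rw [hre]; exact one_pos), heq,
    cpow_def_of_ne_zero (mul_ne_zero ht' hq), log_ofReal_mul ht hq, add_mul, Complex.exp_add,
    ← cpow_def_of_ne_zero hq, Real.sqrt_eq_rpow, Real.rpow_def_of_pos ht]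
  push_cast
  ring

/-- The value of the complex Fresnel integral. -/
lemma tendsto_fresnel :
    Tendsto fresnel atTop (𝓝 (((√Real.pi / 2 : ℝ) : ℂ) * cexp (Real.pi * I / 4))) := by
  obtain ⟨L, hL⟩ := exists_tendsto_fresnel
  have hderiv : ∀ x : ℝ, HasDerivAt (fun x : ℝ => cexp (-1 * (x : ℂ) ^ 2))
      (cexp (-1 * (x : ℂ) ^ 2) * (-1 * (2 * x))) x := fun x => by
    have := ((((hasDerivAt_id (x : ℂ)).pow 2).const_mul (-1)).cexp).comp_ofReal
    simpa using this
  have hre : 0 < (1 : ℂ).re := by simp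
  have hint : IntegrableOn (fun x : ℝ => cexp (-1 * (x : ℂ) ^ 2)) (Ioi 0) :=
    (integrable_cexp_neg_mul_sq hre).integrableOn
  have hint' : IntegrableOn (fun x : ℝ => cexp (-1 * (x : ℂ) ^ 2) * (-1 * (2 * x))) (Ioi 0) := by
    refine ((integrable_mul_cexp_neg_mul_sq hre).integrableOn.const_mul (-2)).congr
      (Eventually.of_forall fun x => ?_)
    simp only
    ring
  have hzero : Tendsto (fun x : ℝ => cexp (-1 * (x : ℂ) ^ 2)) atTop (𝓝 0) :=
    tendsto_zero_of_hasDerivAt_of_integrableOn_Ioi (fun x _ => hderiv x) hint' hint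
  have h := tendsto_sqrt_mul_integral_of_tendsto_fresnel hL (s := id) (s' := fun _ => 1) hderiv
    hasDerivAt_id rfl (fun _ hx => hx) hint' hzero (by simpa using hint)
  have hL' : L = ((√Real.pi / 2 : ℝ) : ℂ) * cexp (Real.pi * I / 4) := by
    refine tendsto_nhds_unique ?_ tendsto_sqrt_mul_gaussian_integral
    simp only [ofReal_zero, ne_eq, OfNat.ofNat_ne_zero, not_false_eq_true, zero_pow, mul_zero,
      Complex.exp_zero, one_mul, ofReal_one, mul_one, id, ← Complex.exp_add] at h
    convert h using 6
    ring
  exact hL' ▸ hL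

section Dispersion

variable {m : ℝ}

lemma hasDerivAt_sqrt_sq_add_sq (hm : 0 < m) (p : ℝ) :
    HasDerivAt (fun p : ℝ => √(p ^ 2 + m ^ 2)) (p / √(p ^ 2 + m ^ 2)) p := by
  have h := (((hasDerivAt_id p).pow 2).add_const (m ^ 2)).sqrt
    (by simp only [Pi.pow_apply, id]; positivity)
  refine h.congr_deriv ?_
  simp only [Pi.pow_apply, id]
  push_cast
  ring

lemma hasDerivAt_sqrt_sqrt_sq_add_sq_add (hm : 0 < m) (p : ℝ) :
    HasDerivAt (fun p : ℝ => √(√(p ^ 2 + m ^ 2) + m))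
      (p / √(p ^ 2 + m ^ 2) / (2 * √(√(p ^ 2 + m ^ 2) + m))) p :=
  ((hasDerivAt_sqrt_sq_add_sq hm p).add_const m).sqrt (by positivity)

/-- The variable `s` with `s² = √(p²+m²) - m`, in a form that is smooth at `p = 0`. -/
noncomputable def phaseVar (m p : ℝ) : ℝ := p / √(√(p ^ 2 + m ^ 2) + m)

/-- The reciprocal of the derivative of `phaseVar m`. -/
noncomputable def phaseJac (m p : ℝ) : ℝ :=
  2 * (√(√(p ^ 2 + m ^ 2) + m) - m / √(√(p ^ 2 + m ^ 2) + m))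

lemma phaseVar_sq (hm : 0 < m) (p : ℝ) : phaseVar m p ^ 2 = √(p ^ 2 + m ^ 2) - m := by
  have hω : √(p ^ 2 + m ^ 2) ^ 2 = p ^ 2 + m ^ 2 := Real.sq_sqrt (by positivity)
  have hpos : 0 < √(p ^ 2 + m ^ 2) + m := by positivity
  rw [phaseVar, div_pow, Real.sq_sqrt hpos.le, div_eq_iff hpos.ne']
  linear_combination -hω

lemma hasDerivAt_phaseVar (hm : 0 < m) (p : ℝ) :
    HasDerivAt (phaseVar m) (phaseJac m p)⁻¹ p := by
  have hr : 0 < √(√(p ^ 2 + m ^ 2) + m) := by positivity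
  have h := (hasDerivAt_id p).div (hasDerivAt_sqrt_sqrt_sq_add_sq_add hm p) hr.ne'
  refine h.congr_deriv ?_
  have hω : √(p ^ 2 + m ^ 2) ^ 2 = p ^ 2 + m ^ 2 := Real.sq_sqrt (by positivity)
  have hω_pos : 0 < √(p ^ 2 + m ^ 2) := by positivity
  have hr2 : √(√(p ^ 2 + m ^ 2) + m) ^ 2 = √(p ^ 2 + m ^ 2) + m := Real.sq_sqrt (by positivity)
  simp only [phaseJac, id]
  generalize √(√(p ^ 2 + m ^ 2) + m) = r at *
  generalize √(p ^ 2 + m ^ 2) = w at *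
  have hk : 2 * (r - m / r) = 2 * w / r := by
    field_simp
    linear_combination hr2
  rw [hk]
  field_simp
  have hp : p ^ 2 = (w - m) * r ^ 2 := by rw [hr2]; linear_combination -hω
  rw [hp]
  linear_combination -r ^ 2 * hr2

lemma hasDerivAt_phaseJac (hm : 0 < m) (p : ℝ) :
    HasDerivAt (phaseJac m) (p / √(p ^ 2 + m ^ 2) / √(√(p ^ 2 + m ^ 2) + m) *
      (1 + m / (√(p ^ 2 + m ^ 2) + m))) p := by
  have hr : 0 < √(√(p ^ 2 + m ^ 2) + m) := by positivity
  have hr2 : √(√(p ^ 2 + m ^ 2) + m) ^ 2 = √(p ^ 2 + m ^ 2) + m := Real.sq_sqrt (by positivity)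
  have hd := hasDerivAt_sqrt_sqrt_sq_add_sq_add hm p
  have h := (hd.sub ((hasDerivAt_const p m).div hd hr.ne')).const_mul 2
  refine h.congr_deriv ?_
  have hω_pos : 0 < √(p ^ 2 + m ^ 2) := by positivity
  have hm' : m / (√(p ^ 2 + m ^ 2) + m) = m / √(√(p ^ 2 + m ^ 2) + m) ^ 2 := by rw [hr2]
  rw [hm']
  field_simp
  ring

lemma phaseJac_pos (hm : 0 < m) (p : ℝ) : 0 < phaseJac m p := by
  have hr : 0 < √(√(p ^ 2 + m ^ 2) + m) := by positivity
  have hr2 : √(√(p ^ 2 + m ^ 2) + m) ^ 2 = √(p ^ 2 + m ^ 2) + m := Real.sq_sqrt (by positivity)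
  have hω_pos : 0 < √(p ^ 2 + m ^ 2) := by positivity
  have : m / √(√(p ^ 2 + m ^ 2) + m) < √(√(p ^ 2 + m ^ 2) + m) := by
    rw [div_lt_iff₀ hr]
    nlinarith
  rw [phaseJac]
  linarith

lemma phaseJac_zero (hm : 0 < m) : phaseJac m 0 = √(2 * m) := by
  have h : √(0 ^ 2 + m ^ 2) + m = 2 * m := by
    rw [zero_pow two_ne_zero, zero_add, Real.sqrt_sq hm.le]; ring
  have hr : 0 < √(2 * m) := by positivity
  have hr2 : √(2 * m) ^ 2 = 2 * m := Real.sq_sqrt (by positivity)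
  rw [phaseJac, h]
  field_simp
  linear_combination hr2

lemma phaseJac_le (hm : 0 < m) (p : ℝ) : phaseJac m p ≤ (1 + 2 * m) + |p| := by
  have hr : 0 < √(√(p ^ 2 + m ^ 2) + m) := by positivity
  have hr2 : √(√(p ^ 2 + m ^ 2) + m) ^ 2 = √(p ^ 2 + m ^ 2) + m := Real.sq_sqrt (by positivity)
  have hω : √(p ^ 2 + m ^ 2) ≤ |p| + m := by
    refine Real.sqrt_le_iff.2 ⟨by positivity, ?_⟩
    nlinarith [sq_abs p, mul_nonneg (abs_nonneg p) hm.le]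
  have hd : 0 ≤ m / √(√(p ^ 2 + m ^ 2) + m) := by positivity
  rw [phaseJac]
  nlinarith [sq_nonneg (√(√(p ^ 2 + m ^ 2) + m) - 1)]

lemma abs_deriv_phaseJac_le (hm : 0 < m) (p : ℝ) :
    |p / √(p ^ 2 + m ^ 2) / √(√(p ^ 2 + m ^ 2) + m) * (1 + m / (√(p ^ 2 + m ^ 2) + m))| ≤
      2 / √m := by
  have hω_pos : 0 < √(p ^ 2 + m ^ 2) := by positivity
  have h1 : |p / √(p ^ 2 + m ^ 2)| ≤ 1 := by
    rw [abs_div, abs_of_pos hω_pos, div_le_one hω_pos]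
    exact Real.abs_le_sqrt (by nlinarith)
  have h2 : √m ≤ √(√(p ^ 2 + m ^ 2) + m) := Real.sqrt_le_sqrt (by linarith)
  have h3 : m / (√(p ^ 2 + m ^ 2) + m) ≤ 1 := by
    rw [div_le_one (by positivity)]
    linarith
  have h4 : 0 ≤ m / (√(p ^ 2 + m ^ 2) + m) := by positivity
  rw [abs_mul, abs_div, abs_of_pos (show 0 < √(√(p ^ 2 + m ^ 2) + m) by positivity),
    abs_of_nonneg (show 0 ≤ 1 + m / (√(p ^ 2 + m ^ 2) + m) by linarith)]
  have h5 : |p / √(p ^ 2 + m ^ 2)| / √(√(p ^ 2 + m ^ 2) + m) ≤ 1 / √m :=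
    div_le_div₀ zero_le_one h1 (by positivity) h2
  calc _ ≤ 1 / √m * 2 := mul_le_mul h5 (by linarith) (by linarith) (by positivity)
    _ = 2 / √m := by ring

end Dispersion

lemma SchwartzMap.hasDerivAt_derivCLM (g : SchwartzMap ℝ ℂ) (p : ℝ) :
    HasDerivAt g (SchwartzMap.derivCLM ℝ ℂ g p) p := by
  rw [SchwartzMap.derivCLM_apply]
  exact g.differentiableAt.hasDerivAt

lemma SchwartzMap.tendsto_atTop_zero (g : SchwartzMap ℝ ℂ) : Tendsto g atTop (𝓝 0) :=
  g.tendsto_cocompact.mono_left atTop_le_cocompact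

/-- A Schwartz function times a continuous function of at most linear growth is integrable. -/
lemma SchwartzMap.integrable_mul_of_norm_le (g : SchwartzMap ℝ ℂ) {k : ℝ → ℝ} {C : ℝ}
    (hk : AEStronglyMeasurable k) (hC : ∀ p, |k p| ≤ C + |p|) :
    Integrable fun p => g p * (k p : ℂ) := by
  have h0 : Integrable fun p => ‖g p‖ := g.integrable.norm
  have h1 : Integrable fun p : ℝ => ‖p‖ ^ 1 * ‖g p‖ := g.integrable_pow_mul volume 1
  refine ((h0.const_mul C).add h1).mono'
    (g.continuous.aestronglyMeasurable.mul
      (continuous_ofReal.comp_aestronglyMeasurable hk)) (Eventually.of_forall fun p => ?_)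
  simp only [Pi.add_apply, norm_mul, norm_real, Real.norm_eq_abs, pow_one]
  nlinarith [hC p, norm_nonneg (g p)]

lemma tendsto_sqrt_mul_integral_schwartz {m : ℝ} (hm : 0 < m) (h : SchwartzMap ℝ ℂ) :
    Tendsto (fun t : ℝ => (√t : ℂ) *
        ∫ p in Ioi (0 : ℝ), h p * cexp (I * t * (phaseVar m p : ℂ) ^ 2)) atTop
      (𝓝 (h 0 * (√(2 * m) : ℂ) * (((√Real.pi / 2 : ℝ) : ℂ) * cexp (Real.pi * I / 4)))) := by
  have hk_cont : Continuous (phaseJac m) :=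
    continuous_iff_continuousAt.2 fun p => (hasDerivAt_phaseJac hm p).continuousAt
  have hk_bound : ∀ p, |phaseJac m p| ≤ (1 + 2 * m) + |p| := fun p => by
    rw [abs_of_pos (phaseJac_pos hm p)]
    exact phaseJac_le hm p
  have hk'_meas : AEStronglyMeasurable (fun p : ℝ => p / √(p ^ 2 + m ^ 2) /
      √(√(p ^ 2 + m ^ 2) + m) * (1 + m / (√(p ^ 2 + m ^ 2) + m))) := by
    have : Measurable (fun p : ℝ => p / √(p ^ 2 + m ^ 2) /
      √(√(p ^ 2 + m ^ 2) + m) * (1 + m / (√(p ^ 2 + m ^ 2) + m))) := by fun_prop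
    exact this.aestronglyMeasurable
  have hcancel : ∀ p, h p * (phaseJac m p : ℂ) * (((phaseJac m p)⁻¹ : ℝ) : ℂ) = h p := fun p => by
    have : (phaseJac m p : ℂ) ≠ 0 := by exact_mod_cast (phaseJac_pos hm p).ne'
    rw [ofReal_inv, mul_assoc, mul_inv_cancel₀ this, mul_one]
  have hlim : Tendsto (fun p : ℝ => h p * (phaseJac m p : ℂ)) atTop (𝓝 0) := by
    have h0 := (h.tendsto_atTop_zero.norm.const_mul (1 + 2 * m)).add
      (SchwartzMap.smulLeftCLM ℂ (fun p : ℝ => (p : ℂ)) h).tendsto_atTop_zero.norm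
    rw [norm_zero, mul_zero, zero_add] at h0
    refine squeeze_zero_norm (fun p => ?_) h0
    rw [SchwartzMap.smulLeftCLM_apply_apply Function.Complex.hasTemperateGrowth_ofReal,
      smul_eq_mul, norm_mul, norm_mul, norm_real, norm_real, Real.norm_eq_abs, Real.norm_eq_abs]
    nlinarith [hk_bound p, norm_nonneg (h p)]
  have key := tendsto_sqrt_mul_integral_of_tendsto_fresnel tendsto_fresnel
    (φ := fun p => h p * (phaseJac m p : ℂ))
    (fun p => (h.hasDerivAt_derivCLM p).mul (hasDerivAt_phaseJac hm p).ofReal_comp)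
    (hasDerivAt_phaseVar hm) (by simp [phaseVar])
    (fun p hp => by rw [phaseVar]; positivity)
    (((SchwartzMap.derivCLM ℝ ℂ h).integrable_mul_of_norm_le hk_cont.aestronglyMeasurable
      hk_bound).add (h.integrable_mul_of_norm_le hk'_meas fun p =>
        (abs_deriv_phaseJac_le hm p).trans (le_add_of_nonneg_right (abs_nonneg p)))).integrableOn
    hlim (by simpa only [hcancel] using h.integrable.integrableOn)
  simpa only [hcancel, phaseJac_zero hm] using key

/-- Integration by parts against the phase `√(p²+m²) t`, for an amplitude vanishing at `0`. -/
lemma integral_mul_exp_sqrt_eq {m t : ℝ} (hm : 0 < m) (ht : t ≠ 0) (g : SchwartzMap ℝ ℂ)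
    (hg : g 0 = 0) :
    ∫ p in Ioi (0 : ℝ), g p * (((p / √(p ^ 2 + m ^ 2) : ℝ) : ℂ) *
        cexp (I * (√(p ^ 2 + m ^ 2) : ℂ) * t)) =
      I / t * ∫ p in Ioi (0 : ℝ), SchwartzMap.derivCLM ℝ ℂ g p *
        cexp (I * (√(p ^ 2 + m ^ 2) : ℂ) * t) := by
  have ht' : (t : ℂ) ≠ 0 := by exact_mod_cast ht
  let v : ℝ → ℂ := fun p => -I / t * cexp (I * (√(p ^ 2 + m ^ 2) : ℂ) * t)
  have hv_cont : Continuous v := by fun_prop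
  have hv_norm : ∀ p, ‖v p‖ ≤ ‖-I / t‖ := fun p => by
    rw [norm_mul, norm_cexp_I_mul_mul, mul_one]
  have hv : ∀ p, HasDerivAt v (((p / √(p ^ 2 + m ^ 2) : ℝ) : ℂ) *
      cexp (I * (√(p ^ 2 + m ^ 2) : ℂ) * t)) p := fun p => by
    have h := ((((hasDerivAt_sqrt_sq_add_sq hm p).ofReal_comp.const_mul I).mul_const
      (t : ℂ)).cexp).const_mul (-I / t : ℂ)
    refine h.congr_deriv ?_
    field_simp
    rw [I_sq, neg_one_mul, neg_neg]
  have h_zero : Tendsto (⇑g * v) (𝓝[>] 0) (𝓝 0) := by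
    have h := (g.continuous.mul hv_cont).tendsto 0
    rw [show (⇑g * v) 0 = 0 by simp [hg]] at h
    exact h.mono_left nhdsWithin_le_nhds
  have h_infty : Tendsto (⇑g * v) atTop (𝓝 0) :=
    g.tendsto_atTop_zero.zero_mul_isBoundedUnder_le
      ⟨‖-I / t‖, eventually_map.2 (Eventually.of_forall hv_norm)⟩
  have hgv' : IntegrableOn (⇑g * fun p : ℝ => ((p / √(p ^ 2 + m ^ 2) : ℝ) : ℂ) *
      cexp (I * (√(p ^ 2 + m ^ 2) : ℂ) * t)) (Ioi 0) := by
    refine (Integrable.mul_bdd (c := 1) g.integrable ?_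
      (Eventually.of_forall fun p => ?_)).integrableOn
    · exact Measurable.aestronglyMeasurable (by fun_prop)
    · rw [norm_mul, norm_cexp_I_mul_mul, mul_one, norm_real, Real.norm_eq_abs, abs_div,
        abs_of_nonneg (Real.sqrt_nonneg _)]
      exact div_le_one_of_le₀ (Real.abs_le_sqrt (by nlinarith [sq_nonneg m])) (Real.sqrt_nonneg _)
  have hg'v : IntegrableOn (⇑(SchwartzMap.derivCLM ℝ ℂ g) * v) (Ioi 0) :=
    (Integrable.mul_bdd (SchwartzMap.derivCLM ℝ ℂ g).integrable hv_cont.aestronglyMeasurable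
      (Eventually.of_forall hv_norm)).integrableOn
  rw [integral_Ioi_mul_deriv_eq_deriv_mul (fun p _ => g.hasDerivAt_derivCLM p) (fun p _ => hv p)
    hgv' hg'v h_zero h_infty, sub_zero, zero_sub, ← integral_neg, ← integral_const_mul]
  congr 1 with p
  simp only [v]
  ring

lemma tendsto_Wt {m : ℝ} (hm : 0 < m) (f : SchwartzMap ℝ ℂ) :
    Tendsto (fun t : ℝ => ((t ^ ((3 : ℝ) / 2) : ℝ) : ℂ) * cexp (-I * (m : ℂ) * (t : ℂ)) * Wt m f t)
      atTop (𝓝 (f 0 * (√(2 * m) : ℂ) * ((√Real.pi / 2 : ℝ) : ℂ) *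
        cexp (3 * Real.pi * I / 4))) := by
  let g : SchwartzMap ℝ ℂ := SchwartzMap.smulLeftCLM ℂ (fun p : ℝ => (p : ℂ)) f
  have hg : ∀ p : ℝ, g p = p * f p := fun p => by
    simp only [g]
    rw [SchwartzMap.smulLeftCLM_apply_apply Function.Complex.hasTemperateGrowth_ofReal, smul_eq_mul]
  have hg' : SchwartzMap.derivCLM ℝ ℂ g 0 = f 0 := by
    have h1 : HasDerivAt (fun p : ℝ => (p : ℂ) * f p)
        (1 * f 0 + ((0 : ℝ) : ℂ) * SchwartzMap.derivCLM ℝ ℂ f 0) 0 :=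
      (hasDerivAt_id (0 : ℝ)).ofReal_comp.mul (f.hasDerivAt_derivCLM 0)
    have h2 := g.hasDerivAt_derivCLM 0
    rw [funext hg] at h2
    simpa using h2.unique h1
  have hconst : f 0 * (√(2 * m) : ℂ) * ((√Real.pi / 2 : ℝ) : ℂ) * cexp (3 * Real.pi * I / 4) =
      I * (SchwartzMap.derivCLM ℝ ℂ g 0 * (√(2 * m) : ℂ) *
        (((√Real.pi / 2 : ℝ) : ℂ) * cexp (Real.pi * I / 4))) := by
    have : cexp (3 * Real.pi * I / 4) = I * cexp (Real.pi * I / 4) := by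
      rw [show (3 * Real.pi * I / 4 : ℂ) = Real.pi / 2 * I + Real.pi * I / 4 by ring,
        Complex.exp_add, exp_pi_div_two_mul_I]
    rw [this, hg']
    ring
  rw [hconst]
  refine ((tendsto_sqrt_mul_integral_schwartz hm (SchwartzMap.derivCLM ℝ ℂ g)).const_mul
    I).congr' ?_
  filter_upwards [eventually_gt_atTop 0] with t ht
  have ht' : (t : ℂ) ≠ 0 := by exact_mod_cast ht.ne'
  have hpow : ((t ^ ((3 : ℝ) / 2) : ℝ) : ℂ) = t * (√t : ℂ) := by
    rw [show (3 : ℝ) / 2 = 1 + 1 / 2 by norm_num, Real.rpow_add ht, Real.rpow_one,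
      ← Real.sqrt_eq_rpow, ofReal_mul]
  have hW : Wt m f t = I / t * ∫ p in Ioi (0 : ℝ), SchwartzMap.derivCLM ℝ ℂ g p *
        cexp (I * (√(p ^ 2 + m ^ 2) : ℂ) * t) := by
    rw [← integral_mul_exp_sqrt_eq hm ht.ne' g (by simp [hg]), Wt]
    congr 1 with p
    rw [hg]
    push_cast
    ring
  have hphase : ∫ p in Ioi (0 : ℝ), SchwartzMap.derivCLM ℝ ℂ g p *
        cexp (I * t * (phaseVar m p : ℂ) ^ 2) = cexp (-I * (m : ℂ) * (t : ℂ)) *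
        ∫ p in Ioi (0 : ℝ), SchwartzMap.derivCLM ℝ ℂ g p *
        cexp (I * (√(p ^ 2 + m ^ 2) : ℂ) * t) := by
    rw [← integral_const_mul]
    congr 1 with p
    have hs : (phaseVar m p : ℂ) ^ 2 = (√(p ^ 2 + m ^ 2) : ℂ) - m := by
      exact_mod_cast phaseVar_sq hm p
    rw [hs, mul_left_comm, ← Complex.exp_add]
    congr 2
    ring
  rw [hphase, hW, hpow]
  field_simp

/-- Since the phase is unimodular, `‖Wt m f t‖` is bounded uniformly in `t`. -/
lemma exists_norm_Wt_le (m : ℝ) (f : SchwartzMap ℝ ℂ) : ∃ M, ∀ t, ‖Wt m f t‖ ≤ M := by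
  refine ⟨∫ p in Ioi (0 : ℝ), ‖f p‖ * ‖(p ^ 2 : ℂ) / (√(p ^ 2 + m ^ 2) : ℂ)‖, fun t => ?_⟩
  refine (norm_integral_le_integral_norm _).trans_eq ?_
  congr 1 with p
  rw [norm_mul, norm_mul, norm_cexp_I_mul_mul, mul_one]

theorem stmt_12 (m : ℝ) (hm : 0 < m) (f : SchwartzMap ℝ ℂ) :
    Filter.Tendsto
      (fun t : ℝ => ((t ^ ((3 : ℝ) / 2) : ℝ) : ℂ) *
        Complex.exp (-Complex.I * (m : ℂ) * (t : ℂ)) * Wt m f t)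
      Filter.atTop
      (nhds (f 0 * (Real.sqrt (2 * m) : ℂ) * ((Real.sqrt Real.pi / 2 : ℝ) : ℂ) *
        Complex.exp (3 * Real.pi * Complex.I / 4))) ∧
    ∃ C : ℝ, ∀ t : ℝ, 1 ≤ t → ‖Wt m f t‖ ≤ C * t ^ (-(3 : ℝ) / 2) := by
  refine ⟨tendsto_Wt hm f, ?_⟩
  obtain ⟨M, hM⟩ := exists_norm_Wt_le m f
  have hM_nonneg : 0 ≤ M := (norm_nonneg _).trans (hM 0)
  obtain ⟨T, hT⟩ := eventually_atTop.1 ((tendsto_Wt hm f).norm.eventually_le_const (lt_add_one _))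
  refine ⟨max (M * T ^ ((3 : ℝ) / 2)) (‖f 0 * (√(2 * m) : ℂ) * ((√Real.pi / 2 : ℝ) : ℂ) *
    cexp (3 * Real.pi * I / 4)‖ + 1), fun t ht => ?_⟩
  have ht_pos : 0 < t := zero_lt_one.trans_le ht
  rw [neg_div, Real.rpow_neg ht_pos.le, ← div_eq_mul_inv, le_div_iff₀ (by positivity)]
  rcases le_total t T with h | h
  · refine le_trans ?_ (le_max_left _ _)
    exact mul_le_mul (hM t) (Real.rpow_le_rpow ht_pos.le h (by norm_num))
      (by positivity) hM_nonneg
  · refine le_trans ?_ (le_max_right _ _)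
    have hexp : ‖cexp (-I * (m : ℂ) * (t : ℂ))‖ = 1 := by
      rw [show -I * (m : ℂ) * (t : ℂ) = ((-(m * t) : ℝ) : ℂ) * I by push_cast; ring]
      exact norm_exp_ofReal_mul_I _
    have := hT t h
    rw [norm_mul, norm_mul, hexp, mul_one, norm_real, Real.norm_of_nonneg (by positivity)] at this
    rw [mul_comm]
    exact this
end
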